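/- arXiv:1404.0989 — 5 statements merged into one kernel-verified Lean document; each statement's English description precedes it below -/
import Mathlib

section
/- Let ã: ℝ^d → S^d and b̃: ℝ^d → ℝ^d be arbitrary maps, let E ⊆ ℝ^d, and define the operator G̃ acting on polynomials f by G̃f(x) = (1/2)·tr(ã(x)·∇²f(x)) + b̃(x)ᵀ·∇f(x). Assume G̃ is well-defined on Pol(E), i.e., for every polynomial f with f = 0 on E one has G̃f = 0 on E. Then the following are equivalent: (1) for every n ∈ ℕ and every polynomial f of degree at most n there is a polynomial g of degree at most n with G̃f = g on E; (2) the property in (1) holds for n = 1 and n = 2; (3) every entry of ã agrees on E with a polynomial of degree at most 2, and every entry of b̃ agrees on E with a polynomial of degree at most 1. Moreover, in this case the restrictions of ã and b̃ to E are uniquely determined by the values of G̃f on E for polynomials f of degree at most 2. -/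
open MvPolynomial

/-- The second order differential operator `G̃f = (1/2) tr(ã ∇²f) + b̃ᵀ ∇f`
applied to a polynomial `f`, evaluated at `x`. -/
noncomputable def Gop {d : ℕ} (a : (Fin d → ℝ) → Matrix (Fin d) (Fin d) ℝ)
    (b : (Fin d → ℝ) → (Fin d → ℝ)) (f : MvPolynomial (Fin d) ℝ) (x : Fin d → ℝ) : ℝ :=
  (1 / 2) * ∑ i, ∑ j, a x i j * eval x (pderiv i (pderiv j f))
    + ∑ i, b x i * eval x (pderiv i f)

/-- `G̃` maps `Pol_n(E)` to itself: for every polynomial of degree at most `n` there is a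
polynomial of degree at most `n` agreeing with `G̃f` on `E`. -/
def MapsPol {d : ℕ} (E : Set (Fin d → ℝ)) (a : (Fin d → ℝ) → Matrix (Fin d) (Fin d) ℝ)
    (b : (Fin d → ℝ) → (Fin d → ℝ)) (n : ℕ) : Prop :=
  ∀ f : MvPolynomial (Fin d) ℝ, f.totalDegree ≤ n →
    ∃ g : MvPolynomial (Fin d) ℝ, g.totalDegree ≤ n ∧ ∀ x ∈ E, Gop a b f x = eval x g

/-- The entries of `ã` (resp. `b̃`) agree on `E` with polynomials of degree at most `2`
(resp. `1`). -/
def PolyCoeffs {d : ℕ} (E : Set (Fin d → ℝ)) (a : (Fin d → ℝ) → Matrix (Fin d) (Fin d) ℝ)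
    (b : (Fin d → ℝ) → (Fin d → ℝ)) : Prop :=
  (∀ i j, ∃ p : MvPolynomial (Fin d) ℝ, p.totalDegree ≤ 2 ∧ ∀ x ∈ E, a x i j = eval x p) ∧
  (∀ i, ∃ p : MvPolynomial (Fin d) ℝ, p.totalDegree ≤ 1 ∧ ∀ x ∈ E, b x i = eval x p)

theorem pderiv_deg {d : ℕ} (i : Fin d) (f : MvPolynomial (Fin d) ℝ) :
    pderiv i f = 0 ∨ (pderiv i f).totalDegree + 1 ≤ f.totalDegree := by
  by_cases h : pderiv i f = 0
  · exact Or.inl h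
  right
  have key : ∀ m ∈ (pderiv i f).support, (m.sum fun _ e => e) + 1 ≤ f.totalDegree := by
    intro m hm
    rw [mem_support_iff, coeff_pderiv] at hm
    have hm' : m + Finsupp.single i 1 ∈ f.support := by
      rw [mem_support_iff]
      exact left_ne_zero_of_mul hm
    have := le_totalDegree hm'
    rw [Finsupp.sum_add_index' (fun _ => rfl) (fun _ _ _ => rfl),
      Finsupp.sum_single_index rfl] at this
    exact this
  obtain ⟨m, hm⟩ := Finset.nonempty_iff_ne_empty.mpr (fun h' => h (support_eq_empty.mp h'))
  have h1 := key m hm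
  have : (pderiv i f).totalDegree ≤ f.totalDegree - 1 :=
    Finset.sup_le fun m hm => by have := key m hm; omega
  omega

theorem Gop_X {d : ℕ} (a : (Fin d → ℝ) → Matrix (Fin d) (Fin d) ℝ)
    (b : (Fin d → ℝ) → (Fin d → ℝ)) (k : Fin d) (x : Fin d → ℝ) :
    Gop a b (X k) x = b x k := by
  have h : ∀ i j : Fin d, pderiv i (pderiv j (X k : MvPolynomial (Fin d) ℝ)) = 0 := by
    intro i j
    by_cases hj : k = j
    · subst hj; simp
    · simp [pderiv_X_of_ne hj]
  have h2 : ∀ i : Fin d, eval x (pderiv i (X k : MvPolynomial (Fin d) ℝ)) =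
      if i = k then 1 else 0 := by
    intro i
    by_cases hj : k = i
    · subst hj; simp
    · simp [pderiv_X_of_ne hj, Ne.symm hj]
  simp [Gop, h, h2, -pderiv_X]

theorem Gop_XX {d : ℕ} (a : (Fin d → ℝ) → Matrix (Fin d) (Fin d) ℝ)
    (b : (Fin d → ℝ) → (Fin d → ℝ)) (k l : Fin d) (x : Fin d → ℝ) (hs : (a x).IsSymm) :
    Gop a b (X k * X l) x = a x k l + b x k * x l + b x l * x k := by
  have hX : ∀ i k : Fin d, pderiv i (X k : MvPolynomial (Fin d) ℝ) =
      C (if i = k then 1 else 0) := by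
    intro i k
    by_cases hj : k = i
    · subst hj; simp
    · simp [pderiv_X_of_ne hj, Ne.symm hj]
  have h1 : ∀ i : Fin d, eval x (pderiv i (X k * X l : MvPolynomial (Fin d) ℝ)) =
      (if i = k then 1 else 0) * x l + x k * (if i = l then 1 else 0) := by
    intro i
    rw [pderiv_mul, hX, hX]; simp only [map_add, map_mul, eval_C, eval_X]
  have h2 : ∀ i j : Fin d, eval x (pderiv i (pderiv j (X k * X l : MvPolynomial (Fin d) ℝ))) =
      (if j = k then 1 else 0) * (if i = l then 1 else 0)
        + (if i = k then 1 else 0) * (if j = l then 1 else 0) := by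
    intro i j
    rw [pderiv_mul, hX, hX, map_add, pderiv_mul, pderiv_mul, hX, hX, pderiv_C, pderiv_C]
    simp only [map_add, map_mul, eval_C, eval_X, map_zero, zero_mul, mul_zero, zero_add, add_zero]
  have e := hs.apply k l
  simp only [Gop, h1, h2, mul_add, Finset.sum_add_distrib]
  simp [← mul_assoc]
  rw [e]; ring

theorem maps_of_poly {d : ℕ} (E : Set (Fin d → ℝ))
    (a : (Fin d → ℝ) → Matrix (Fin d) (Fin d) ℝ) (b : (Fin d → ℝ) → (Fin d → ℝ))
    (h : PolyCoeffs E a b) (n : ℕ) : MapsPol E a b n := by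
  obtain ⟨ha, hb⟩ := h
  choose p hp hpe using ha
  choose q hq hqe using hb
  intro f hf
  refine ⟨C (1 / 2) * ∑ i, ∑ j, p i j * pderiv i (pderiv j f) + ∑ i, q i * pderiv i f, ?_, ?_⟩
  · refine (totalDegree_add _ _).trans (max_le ?_ ?_)
    · refine (totalDegree_mul _ _).trans ?_
      rw [totalDegree_C, zero_add]
      refine totalDegree_finsetSum_le fun i _ => totalDegree_finsetSum_le fun j _ => ?_
      rcases pderiv_deg i (pderiv j f) with h0 | h1
      · simp [h0]
      rcases pderiv_deg j f with h0 | h2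
      · simp [h0]
      have := totalDegree_mul (p i j) (pderiv i (pderiv j f))
      have := hp i j
      omega
    · refine totalDegree_finsetSum_le fun i _ => ?_
      rcases pderiv_deg i f with h0 | h2
      · simp [h0]
      have := totalDegree_mul (q i) (pderiv i f)
      have := hq i
      omega
  · intro x hx
    simp only [Gop, map_add, map_mul, map_sum, eval_C]
    congr 1
    · congr 1
      refine Finset.sum_congr rfl fun i _ => Finset.sum_congr rfl fun j _ => ?_
      rw [hpe i j x hx]
    · refine Finset.sum_congr rfl fun i _ => ?_
      rw [hqe i x hx]

theorem poly_of_maps {d : ℕ} (E : Set (Fin d → ℝ))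
    (a : (Fin d → ℝ) → Matrix (Fin d) (Fin d) ℝ) (b : (Fin d → ℝ) → (Fin d → ℝ))
    (ha : ∀ x, (a x).IsSymm)
    (h1 : MapsPol E a b 1) (h2 : MapsPol E a b 2) : PolyCoeffs E a b := by
  have hb : ∀ i, ∃ p : MvPolynomial (Fin d) ℝ, p.totalDegree ≤ 1 ∧ ∀ x ∈ E, b x i = eval x p := by
    intro i
    obtain ⟨g, hg, hge⟩ := h1 (X i) (totalDegree_X i).le
    exact ⟨g, hg, fun x hx => by rw [← hge x hx, Gop_X]⟩
  refine ⟨fun k l => ?_, hb⟩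
  choose q hq hqe using hb
  have hdeg : ∀ (r : MvPolynomial (Fin d) ℝ) (k : Fin d), r.totalDegree ≤ 1 →
      (r * X k).totalDegree ≤ 2 := by
    intro r k hr
    have := totalDegree_mul r (X k)
    rw [totalDegree_X] at this
    omega
  obtain ⟨g, hg, hge⟩ := h2 (X k * X l) (hdeg _ _ (totalDegree_X k).le)
  refine ⟨g - q k * X l - q l * X k, ?_, fun x hx => ?_⟩
  · exact (totalDegree_sub _ _).trans (max_le ((totalDegree_sub _ _).trans
      (max_le hg (hdeg _ _ (hq k)))) (hdeg _ _ (hq l)))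
  · have := hge x hx
    rw [Gop_XX a b k l x (ha x)] at this
    simp only [map_sub, map_mul, eval_X, ← this, ← hqe _ x hx]
    ring

theorem stmt0 {d : ℕ} (E : Set (Fin d → ℝ))
    (a : (Fin d → ℝ) → Matrix (Fin d) (Fin d) ℝ) (b : (Fin d → ℝ) → (Fin d → ℝ))
    (ha_symm : ∀ x, (a x).IsSymm)
    (hwd : ∀ f : MvPolynomial (Fin d) ℝ, (∀ x ∈ E, eval x f = 0) →
      ∀ x ∈ E, Gop a b f x = 0) :
    ((∀ n : ℕ, MapsPol E a b n) ↔ (MapsPol E a b 1 ∧ MapsPol E a b 2)) ∧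
    ((MapsPol E a b 1 ∧ MapsPol E a b 2) ↔ PolyCoeffs E a b) ∧
    (PolyCoeffs E a b →
      ∀ (a' : (Fin d → ℝ) → Matrix (Fin d) (Fin d) ℝ) (b' : (Fin d → ℝ) → (Fin d → ℝ)),
        (∀ x, (a' x).IsSymm) →
        (∀ f : MvPolynomial (Fin d) ℝ, (∀ x ∈ E, eval x f = 0) →
          ∀ x ∈ E, Gop a' b' f x = 0) →
        (∀ f : MvPolynomial (Fin d) ℝ, f.totalDegree ≤ 2 →
          ∀ x ∈ E, Gop a' b' f x = Gop a b f x) →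
        ∀ x ∈ E, a' x = a x ∧ b' x = b x) := by
  refine ⟨⟨fun h => ⟨h 1, h 2⟩, fun h => maps_of_poly E a b (poly_of_maps E a b ha_symm h.1 h.2)⟩,
    ⟨fun h => poly_of_maps E a b ha_symm h.1 h.2,
      fun h => ⟨maps_of_poly E a b h 1, maps_of_poly E a b h 2⟩⟩, ?_⟩
  intro _ a' b' hs' _ hG x hx
  have hb : ∀ k, b' x k = b x k := by
    intro k
    have := hG (X k) (by rw [totalDegree_X]; norm_num) x hx
    rwa [Gop_X, Gop_X] at this
  refine ⟨?_, funext hb⟩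
  ext k l
  have := hG (X k * X l) ((totalDegree_mul _ _).trans (by simp [totalDegree_X])) x hx
  rw [Gop_XX _ _ _ _ _ (hs' x), Gop_XX _ _ _ _ _ (ha_symm x), hb, hb] at this
  linarith
end

section
/- Let Q ∈ ℝ^{d×d} be a diagonal matrix whose diagonal entries lie in {−1, +1}. If L: ℝ^d → S^d is a map each of whose entries L_{ij}(x) is a linear form in x (i.e., L is linear into the space of real symmetric d×d matrices), and L(x)·Qx = 0 for all x ∈ ℝ^d, then L = 0. -/
open Matrix

theorem stmt9 {d : ℕ} (Qd : Fin d → ℝ) (hQpm : ∀ i, Qd i = 1 ∨ Qd i = -1)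
    (L : (Fin d → ℝ) →ₗ[ℝ] Matrix (Fin d) (Fin d) ℝ)
    (hsymm : ∀ x, (L x).IsSymm)
    (hker : ∀ x : Fin d → ℝ, (L x).mulVec ((Matrix.diagonal Qd).mulVec x) = 0) :
    L = 0 := by
  have key : ∀ k i j : Fin d, L (Pi.single k 1) i j * Qd j = -(L (Pi.single j 1) i k * Qd k) := by
    intro k i j
    have h1 := congrFun (hker (Pi.single k 1 + Pi.single j 1)) i
    have h2 := congrFun (hker (Pi.single k 1)) i
    have h3 := congrFun (hker (Pi.single j 1)) i
    have e : ∀ k : Fin d, (Matrix.diagonal Qd).mulVec (Pi.single k 1) = Pi.single k (Qd k) := by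
      intro k
      simp
    simp only [map_add, Matrix.mulVec_add, Matrix.add_apply, e, Pi.add_apply, Pi.zero_apply,
      Matrix.mulVec_single, Pi.smul_apply, Matrix.col_apply, MulOpposite.smul_eq_mul_unop,
      MulOpposite.unop_op] at h1 h2 h3
    linarith
  have sy : ∀ k i j : Fin d, L (Pi.single k 1) i j = L (Pi.single k 1) j i :=
    fun k i j => (hsymm (Pi.single k 1)).apply j i
  have hz : ∀ k i j : Fin d, L (Pi.single k 1) i j = 0 := by
    intro k i j
    have h1 := key k i j
    have h2 := key j k i
    have h3 := key i j k
    rw [sy j k i] at h2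
    rw [sy i j k] at h3
    rw [sy k j i] at h3
    rcases hQpm i with hi | hi <;> rcases hQpm j with hj | hj <;> rcases hQpm k with hk | hk <;>
      simp only [hi, hj, hk] at h1 h2 h3 <;> linarith
  apply LinearMap.pi_ext'
  intro k
  ext i j
  simpa using hz k i j
end

section
/- Let Q ∈ ℝ^{d×d} be a diagonal matrix whose diagonal entries lie in {−1, +1}. For every map g: ℝ^d → ℝ^d each of whose components g_k(x) is a homogeneous polynomial of degree 2 in x (a quadratic form on ℝ^d), there exists a map K: ℝ^d → S^d, each of whose entries is a linear form in x, such that K(x)·Qx = g(x) for all x ∈ ℝ^d. -/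
open MvPolynomial Matrix

lemma quad_repr {d : ℕ} (p : MvPolynomial (Fin d) ℝ) (hp : p.IsHomogeneous 2) :
    ∃ c : Fin d → Fin d → ℝ, (∀ i j, c i j = c j i) ∧
      ∀ x, eval x p = ∑ i, ∑ j, c i j * (x i * x j) := by
  have hc : ∀ i j, pderiv j (pderiv i p) = C (coeff 0 (pderiv j (pderiv i p))) := by
    intro i j
    have h : (pderiv j (pderiv i p)).IsHomogeneous 0 := by
      simpa using (hp.pderiv (i := i)).pderiv (i := j)
    exact (totalDegree_eq_zero_iff_eq_C).1 ((totalDegree_zero_iff_isHomogeneous _).2 h)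
  have hcomm : ∀ i j, pderiv j (pderiv i p) = pderiv i (pderiv j p) := by
    intro i j
    have h : ⁅(pderiv j : Derivation ℝ (MvPolynomial (Fin d) ℝ) (MvPolynomial (Fin d) ℝ)),
        (pderiv i : Derivation ℝ (MvPolynomial (Fin d) ℝ) (MvPolynomial (Fin d) ℝ))⁆ = 0 := by
      apply MvPolynomial.derivation_ext
      intro k
      simp [Derivation.commutator_apply, pderiv_X, Pi.single_apply, apply_ite]
    have h2 := congrArg (fun D => D p) h
    simpa [Derivation.commutator_apply, sub_eq_zero] using h2
  refine ⟨fun i j => coeff 0 (pderiv j (pderiv i p)) / 2, fun i j => ?_, fun x => ?_⟩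
  · simp only [hcomm i j]
  · have e1 := congrArg (eval x) hp.sum_X_mul_pderiv
    have e2 : ∀ i, eval x (pderiv i p) = ∑ j, x j * coeff 0 (pderiv j (pderiv i p)) := by
      intro i
      have e := congrArg (eval x) (hp.pderiv (i := i)).sum_X_mul_pderiv
      simp only [map_sum, map_mul, eval_X, map_nsmul] at e
      rw [show (2 - 1 : ℕ) = 1 from rfl, one_smul] at e
      rw [← e]
      refine Finset.sum_congr rfl fun j _ => ?_
      conv_lhs => rw [hc i j, eval_C]
    simp only [map_sum, map_mul, eval_X, map_nsmul, e2] at e1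
    have : eval x p = (2 • eval x p) / 2 := by rw [nsmul_eq_mul]; push_cast; ring
    rw [this, ← e1, Finset.sum_div]
    refine Finset.sum_congr rfl fun i _ => ?_
    rw [Finset.mul_sum, Finset.sum_div]
    exact Finset.sum_congr rfl fun j _ => by ring

theorem stmt10 {d : ℕ} (Qd : Fin d → ℝ) (hQpm : ∀ i, Qd i = 1 ∨ Qd i = -1)
    (g : (Fin d → ℝ) → (Fin d → ℝ))
    (hg : ∀ k, ∃ p : MvPolynomial (Fin d) ℝ, p.IsHomogeneous 2 ∧ ∀ x, g x k = eval x p) :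
    ∃ K : (Fin d → ℝ) → Matrix (Fin d) (Fin d) ℝ,
      (∀ x, (K x).IsSymm) ∧
      (∀ i j, ∃ p : MvPolynomial (Fin d) ℝ, p.IsHomogeneous 1 ∧ ∀ x, K x i j = eval x p) ∧
      (∀ x : Fin d → ℝ, (K x).mulVec ((Matrix.diagonal Qd).mulVec x) = g x) := by
  have hq : ∀ i, Qd i * Qd i = 1 := by
    intro i
    rcases hQpm i with h | h <;> rw [h] <;> norm_num
  have hc : ∀ k, ∃ c : Fin d → Fin d → ℝ, (∀ i j, c i j = c j i) ∧
      ∀ x, g x k = ∑ i, ∑ j, c i j * ((Qd i * x i) * (Qd j * x j)) := by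
    intro k
    obtain ⟨p, hp, hpe⟩ := hg k
    obtain ⟨c, hs, he⟩ := quad_repr p hp
    refine ⟨fun i j => c i j * (Qd i * Qd j), fun i j => ?_, fun x => ?_⟩
    · simp only [hs i j, mul_comm (Qd i)]
    · rw [hpe, he]
      refine Finset.sum_congr rfl fun i _ => Finset.sum_congr rfl fun j _ => ?_
      linear_combination (-(c i j * x i * x j)) * (Qd j * Qd j * hq i + hq j)
  choose c hs he using hc
  refine ⟨fun x => Matrix.of fun k j => ∑ i, (c k i j + c j i k - c i k j) * (Qd i * x i),
    fun x => ?_, fun k j => ?_, fun x => ?_⟩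
  · ext k j
    simp only [Matrix.transpose_apply, Matrix.of_apply]
    refine Finset.sum_congr rfl fun i _ => ?_
    rw [hs i j k]; ring
  · refine ⟨∑ i, C ((c k i j + c j i k - c i k j) * Qd i) * X i, ?_, fun x => ?_⟩
    · refine IsHomogeneous.sum _ _ _ fun i _ => ?_
      simpa using (isHomogeneous_C (Fin d) ((c k i j + c j i k - c i k j) * Qd i)).mul
        (isHomogeneous_X ℝ i)
    · simp [mul_assoc]
  · ext k
    have hsw : ∑ j, ∑ i, c j i k * ((Qd i * x i) * (Qd j * x j))
        = ∑ j, ∑ i, c i k j * ((Qd i * x i) * (Qd j * x j)) := by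
      rw [Finset.sum_comm]
      refine Finset.sum_congr rfl fun i _ => Finset.sum_congr rfl fun j _ => ?_
      rw [hs j i k]; ring
    have hk : ∑ j, ∑ i, c k i j * ((Qd i * x i) * (Qd j * x j)) = g x k := by
      rw [he, Finset.sum_comm]
    simp only [Matrix.mulVec, dotProduct, Matrix.of_apply,
      Matrix.diagonal_apply, ite_mul, zero_mul, Finset.sum_ite_eq, Finset.mem_univ, if_true]
    calc _ = ∑ j, ∑ i, c k i j * ((Qd i * x i) * (Qd j * x j))
          + ∑ j, ∑ i, c j i k * ((Qd i * x i) * (Qd j * x j))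
          - ∑ j, ∑ i, c i k j * ((Qd i * x i) * (Qd j * x j)) := by
          simp only [← Finset.sum_add_distrib, ← Finset.sum_sub_distrib, Finset.sum_mul]
          refine Finset.sum_congr rfl fun j _ => Finset.sum_congr rfl fun i _ => ?_
          ring
      _ = g x k := by rw [hsw, hk]; ring
end

section
/- Let A be a real symmetric d×d matrix with spectral decomposition A = S·Λ·Sᵀ (S orthogonal, Λ the diagonal matrix of eigenvalues), and let π(A) = S·Λ⁺·Sᵀ denote its positive semidefinite part, where Λ⁺ is the entrywise positive part of Λ. Suppose v, w ∈ ℝ^d and t ∈ ℝ satisfy A·v = t·w. Then vᵀ·π(A)·v ≤ |t| · d · ‖v‖ · ‖w‖, where ‖·‖ is the Euclidean norm on ℝ^d. -/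
open Matrix

theorem norm_aux {d : ℕ} (S : Matrix (Fin d) (Fin d) ℝ) (hS : S * Sᵀ = 1) (v : Fin d → ℝ) :
    ∑ i, (Sᵀ.mulVec v i) ^ 2 = ∑ i, (v i) ^ 2 := by
  have h : Sᵀ.mulVec v ⬝ᵥ Sᵀ.mulVec v = v ⬝ᵥ v := by
    rw [Matrix.dotProduct_mulVec, Matrix.vecMul_transpose, Matrix.mulVec_mulVec, hS,
      Matrix.one_mulVec]
  simpa [dotProduct, pow_two] using h

theorem stmt13 {d : ℕ} (A S : Matrix (Fin d) (Fin d) ℝ) (Λ : Fin d → ℝ)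
    (hA : A.IsSymm) (hS : S * Sᵀ = 1) (hS' : Sᵀ * S = 1)
    (hdec : A = S * Matrix.diagonal Λ * Sᵀ)
    (v w : Fin d → ℝ) (t : ℝ) (hvw : A.mulVec v = t • w) :
    v ⬝ᵥ (S * Matrix.diagonal (fun i => max (Λ i) 0) * Sᵀ).mulVec v ≤
      |t| * d * Real.sqrt (∑ i, (v i) ^ 2) * Real.sqrt (∑ i, (w i) ^ 2) := by
  have hz : ∀ i, Λ i * Sᵀ.mulVec v i = t * Sᵀ.mulVec w i := by
    have h : Sᵀ.mulVec (A.mulVec v) = Sᵀ.mulVec (t • w) := by rw [hvw]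
    rw [hdec, Matrix.mulVec_mulVec, ← Matrix.mul_assoc, ← Matrix.mul_assoc, hS', Matrix.one_mul,
      ← Matrix.mulVec_mulVec, Matrix.mulVec_smul] at h
    intro i
    have := congrFun h i
    simpa [Matrix.mulVec_diagonal] using this
  have hL : v ⬝ᵥ (S * Matrix.diagonal (fun i => max (Λ i) 0) * Sᵀ).mulVec v
      = ∑ i, Sᵀ.mulVec v i * (max (Λ i) 0 * Sᵀ.mulVec v i) := by
    rw [← Matrix.mulVec_mulVec, ← Matrix.mulVec_mulVec, Matrix.dotProduct_mulVec,
      ← Matrix.mulVec_transpose]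
    simp only [dotProduct, Matrix.mulVec_diagonal]
  rw [hL, ← norm_aux S hS v, ← norm_aux S hS w]
  generalize Sᵀ.mulVec v = u at *
  generalize Sᵀ.mulVec w = z at *
  have h1 : ∑ i, u i * (max (Λ i) 0 * u i) ≤ |t| * ∑ i, |u i| * |z i| := by
    rw [Finset.mul_sum]
    refine Finset.sum_le_sum fun i _ => ?_
    have e : |t| * (|u i| * |z i|) = |Λ i| * (u i * u i) := by
      rw [← abs_mul_abs_self (u i), ← mul_assoc (|Λ i|), ← abs_mul (Λ i), hz, abs_mul]; ring
    rw [e]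
    have : max (Λ i) 0 ≤ |Λ i| := max_le (le_abs_self _) (abs_nonneg _)
    nlinarith [mul_self_nonneg (u i)]
  have h2 := Real.sum_mul_le_sqrt_mul_sqrt Finset.univ (fun i => |u i|) (fun i => |z i|)
  simp only [sq_abs] at h2
  rcases Nat.eq_zero_or_pos d with rfl | hd
  · simp
  have hd' : (1 : ℝ) ≤ d := by exact_mod_cast hd
  refine h1.trans ((mul_le_mul_of_nonneg_left h2 (abs_nonneg t)).trans ?_)
  have hp : 0 ≤ |t| * (√(∑ i, u i ^ 2) * √(∑ i, z i ^ 2)) := by positivity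
  nlinarith
end

section
/- Let Q = {q₁,…,q_m} be a finite set of polynomials on ℝ^d with common zero set M = {x ∈ ℝ^d : q(x) = 0 for all q ∈ Q}, let P be a finite set of polynomials on ℝ^d, and let E = {x ∈ M : p(x) ≥ 0 for all p ∈ P}. Let a: ℝ^d → S^d have entries that are polynomials of degree at most 2, let b: ℝ^d → ℝ^d have entries that are polynomials of degree at most 1, and let G be the associated operator. Assume: (G1) the gradients ∇q₁(x),…,∇q_m(x) are linearly independent for every x ∈ M; (A0) a(x) is positive semidefinite for every x ∈ E; and (A2) a(x)·∇q(x) = 0 and Gq(x) = 0 for every x ∈ M and every q ∈ Q. Let â(x) denote the metric projection (in Frobenius norm) of a(x) onto the cone of positive semidefinite matrices. Then there exists a continuous map b̂: ℝ^d → ℝ^d with b̂ = b on E such that the operator Ĝf(x) = (1/2)·tr(â(x)·∇²f(x)) + b̂(x)ᵀ·∇f(x) satisfies Ĝf = Gf on E for every twice continuously differentiable f, and Ĝq = 0 on M for every q ∈ Q. -/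
open MvPolynomial Matrix

/-- The second order differential operator `Gf = (1/2) tr(a ∇²f) + bᵀ ∇f`
applied to a twice continuously differentiable `f`, evaluated at `x`. -/
noncomputable def GopC {d : ℕ} (a : (Fin d → ℝ) → Matrix (Fin d) (Fin d) ℝ)
    (b : (Fin d → ℝ) → (Fin d → ℝ)) (f : (Fin d → ℝ) → ℝ) (x : Fin d → ℝ) : ℝ :=
  (1 / 2) * ∑ i, ∑ j, a x i j *
      fderiv ℝ (fun y => fderiv ℝ f y (Pi.single j 1)) x (Pi.single i 1)
    + ∑ i, b x i * fderiv ℝ f x (Pi.single i 1)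

/-- The Frobenius norm of a real `d × d` matrix. -/
noncomputable def frobNorm {d : ℕ} (M : Matrix (Fin d) (Fin d) ℝ) : ℝ :=
  Real.sqrt (∑ i, ∑ j, (M i j) ^ 2)

lemma hasFDerivAt_mv {d : ℕ} (p : MvPolynomial (Fin d) ℝ) (x : Fin d → ℝ) :
    HasFDerivAt (fun y => eval y p)
      (∑ i, eval x (pderiv i p) • (ContinuousLinearMap.proj i : (Fin d → ℝ) →L[ℝ] ℝ)) x := by
  induction p using MvPolynomial.induction_on with
  | C r => simpa using hasFDerivAt_const r x
  | add p q hp hq =>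
    have := hp.add hq
    simp only [map_add, add_smul, Finset.sum_add_distrib]
    exact this
  | mul_X p n hp =>
    have h2 : HasFDerivAt (fun y : Fin d → ℝ => y n)
      (ContinuousLinearMap.proj n : (Fin d → ℝ) →L[ℝ] ℝ) x := hasFDerivAt_apply n x
    have := hp.mul h2
    simp only [map_mul, eval_X]
    refine this.congr_fderiv ?_
    ext v
    simp [pderiv_X, Pi.single_apply, Finset.sum_add_distrib, Finset.mul_sum, add_mul,
      apply_ite, ite_mul]
    try ring_nf

lemma fderiv_mv {d : ℕ} (p : MvPolynomial (Fin d) ℝ) (x : Fin d → ℝ) (i : Fin d) :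
    fderiv ℝ (fun y => eval y p) x (Pi.single i 1) = eval x (pderiv i p) := by
  rw [(hasFDerivAt_mv p x).fderiv]
  simp [Pi.single_apply]

lemma GopC_mv {d : ℕ} (a : (Fin d → ℝ) → Matrix (Fin d) (Fin d) ℝ)
    (b : (Fin d → ℝ) → (Fin d → ℝ)) (p : MvPolynomial (Fin d) ℝ) (x : Fin d → ℝ) :
    GopC a b (fun y => eval y p) x = (1 / 2) * ∑ i, ∑ j, a x i j *
      eval x (pderiv i (pderiv j p)) + ∑ i, b x i * eval x (pderiv i p) := by
  simp only [GopC, fderiv_mv]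

lemma frob_le {d : ℕ} {A B : Matrix (Fin d) (Fin d) ℝ} (h : frobNorm A ≤ frobNorm B) :
    ∑ i, ∑ j, (A i j) ^ 2 ≤ ∑ i, ∑ j, (B i j) ^ 2 := by
  unfold frobNorm at h
  exact (Real.sqrt_le_sqrt_iff (by positivity)).1 h

lemma var_ineq {d : ℕ} {A Q : Matrix (Fin d) (Fin d) ℝ} (hQ : Q.PosSemidef)
    (h : ∀ B : Matrix (Fin d) (Fin d) ℝ, B.PosSemidef → frobNorm (A - Q) ≤ frobNorm (A - B))
    (B : Matrix (Fin d) (Fin d) ℝ) (hB : B.PosSemidef) :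
    ∑ i, ∑ j, (A i j - Q i j) * (B i j - Q i j) ≤ 0 := by
  set S := ∑ i, ∑ j, (A i j - Q i j) * (B i j - Q i j) with hS
  set N := ∑ i, ∑ j, (B i j - Q i j) ^ 2 with hN
  have hN0 : 0 ≤ N := by positivity
  have key : ∀ t : ℝ, 0 ≤ t → t ≤ 1 → 2 * t * S ≤ t ^ 2 * N := by
    intro t h0 h1
    have hp : ((1 - t) • Q + t • B).PosSemidef :=
      (hQ.smul (by linarith)).add (hB.smul h0)
    have h2 := frob_le (h _ hp)
    have h3 : ∑ i, ∑ j, ((A - ((1 - t) • Q + t • B)) i j) ^ 2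
        = ∑ i, ∑ j, ((A - Q) i j) ^ 2 - 2 * t * S + t ^ 2 * N := by
      simp only [hS, hN, Finset.mul_sum, ← Finset.sum_sub_distrib, ← Finset.sum_add_distrib]
      refine Finset.sum_congr rfl fun i _ => Finset.sum_congr rfl fun j _ => ?_
      simp only [Matrix.sub_apply, Matrix.add_apply, Matrix.smul_apply, smul_eq_mul]
      ring
    linarith
  by_contra hc
  push Not at hc
  have hpos : 0 < S + N := by linarith
  have := key (S / (S + N)) (by positivity) (by rw [div_le_one hpos]; linarith)
  have h5 : 2 * (S / (S + N)) * S = (S / (S + N)) ^ 2 * (2 * (S + N)) := by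
    field_simp
  rw [h5] at this
  have h6 : 0 < (S / (S + N)) ^ 2 := by positivity
  have := le_of_mul_le_mul_left this h6
  linarith

lemma nonexp {d : ℕ} {A Q A' Q' : Matrix (Fin d) (Fin d) ℝ} (hQ : Q.PosSemidef)
    (h : ∀ B : Matrix (Fin d) (Fin d) ℝ, B.PosSemidef → frobNorm (A - Q) ≤ frobNorm (A - B))
    (hQ' : Q'.PosSemidef)
    (h' : ∀ B : Matrix (Fin d) (Fin d) ℝ, B.PosSemidef → frobNorm (A' - Q') ≤ frobNorm (A' - B)) :
    ∑ i, ∑ j, (Q i j - Q' i j) ^ 2 ≤ ∑ i, ∑ j, (A i j - A' i j) ^ 2 := by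
  have h1 := var_ineq hQ h Q' hQ'
  have h2 := var_ineq hQ' h' Q hQ
  have h3 : ∑ i, ∑ j, (Q i j - Q' i j) ^ 2 - ∑ i, ∑ j, (A i j - A' i j) ^ 2 ≤
     2 * (∑ i, ∑ j, (A i j - Q i j) * (Q' i j - Q i j)) +
     2 * ∑ i, ∑ j, (A' i j - Q' i j) * (Q i j - Q' i j) := by
    simp only [Finset.mul_sum, ← Finset.sum_sub_distrib, ← Finset.sum_add_distrib]
    refine Finset.sum_le_sum fun i _ => Finset.sum_le_sum fun j _ => ?_
    nlinarith [sq_nonneg ((A i j - A' i j) - (Q i j - Q' i j))]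
  linarith

lemma proj_cont {d : ℕ} (a ahat : (Fin d → ℝ) → Matrix (Fin d) (Fin d) ℝ)
    (ha : ∀ i j, Continuous fun x => a x i j)
    (hahat : ∀ x, (ahat x).PosSemidef ∧
      ∀ B : Matrix (Fin d) (Fin d) ℝ, B.PosSemidef →
        frobNorm (a x - ahat x) ≤ frobNorm (a x - B)) (i j : Fin d) :
    Continuous fun x => ahat x i j := by
  rw [continuous_iff_continuousAt]
  intro x
  have hc : Continuous fun y => Real.sqrt (∑ i, ∑ j, (a y i j - a x i j) ^ 2) := by fun_prop
  have ht := hc.tendsto x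
  simp only [sub_self] at ht
  rw [ContinuousAt, tendsto_iff_dist_tendsto_zero]
  refine squeeze_zero (fun _ => dist_nonneg) (fun y => ?_) (by simpa using ht)
  rw [Real.dist_eq]
  apply Real.abs_le_sqrt
  refine le_trans ?_ (nonexp (hahat y).1 (hahat y).2 (hahat x).1 (hahat x).2)
  refine le_trans ?_ (Finset.single_le_sum (f := fun i => ∑ j, (ahat y i j - ahat x i j) ^ 2)
    (fun i _ => by positivity) (Finset.mem_univ i))
  exact Finset.single_le_sum (f := fun j => (ahat y i j - ahat x i j) ^ 2)
    (fun i _ => by positivity) (Finset.mem_univ j)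

theorem stmt15 {d m : ℕ} (q : Fin m → MvPolynomial (Fin d) ℝ)
    (P : Finset (MvPolynomial (Fin d) ℝ))
    (M : Set (Fin d → ℝ)) (hM : M = {x | ∀ k, eval x (q k) = 0})
    (E : Set (Fin d → ℝ)) (hE : E = {x ∈ M | ∀ p ∈ P, 0 ≤ eval x p})
    (a : (Fin d → ℝ) → Matrix (Fin d) (Fin d) ℝ) (b : (Fin d → ℝ) → (Fin d → ℝ))
    (ha_symm : ∀ x, (a x).IsSymm)
    (ha_poly : ∀ i j, ∃ p : MvPolynomial (Fin d) ℝ, p.totalDegree ≤ 2 ∧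
      ∀ x, a x i j = eval x p)
    (hb_poly : ∀ i, ∃ p : MvPolynomial (Fin d) ℝ, p.totalDegree ≤ 1 ∧
      ∀ x, b x i = eval x p)
    -- (G1): the gradients ∇q₁(x),…,∇q_m(x) are linearly independent on M
    (hG1 : ∀ x ∈ M, LinearIndependent ℝ
      (fun (k : Fin m) (i : Fin d) => eval x (pderiv i (q k))))
    -- (A0)
    (hA0 : ∀ x ∈ E, (a x).PosSemidef)
    -- (A2)
    (hA2 : ∀ x ∈ M, ∀ k, (a x).mulVec (fun i => eval x (pderiv i (q k))) = 0 ∧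
      GopC a b (fun y => eval y (q k)) x = 0)
    -- â(x): the metric projection of a(x) onto the positive semidefinite cone
    (ahat : (Fin d → ℝ) → Matrix (Fin d) (Fin d) ℝ)
    (hahat : ∀ x, (ahat x).PosSemidef ∧
      ∀ B : Matrix (Fin d) (Fin d) ℝ, B.PosSemidef →
        frobNorm (a x - ahat x) ≤ frobNorm (a x - B)) :
    ∃ bhat : (Fin d → ℝ) → (Fin d → ℝ),
      Continuous bhat ∧
      (∀ x ∈ E, bhat x = b x) ∧
      (∀ f : (Fin d → ℝ) → ℝ, ContDiff ℝ 2 f → ∀ x ∈ E, GopC ahat bhat f x = GopC a b f x) ∧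
      (∀ k, ∀ x ∈ M, GopC ahat bhat (fun y => eval y (q k)) x = 0) := by
  have ha : ∀ i j, Continuous fun x => a x i j := by
    intro i j
    obtain ⟨p, -, hp⟩ := ha_poly i j
    simp only [hp]
    exact MvPolynomial.continuous_eval p
  have hb : Continuous b := by
    refine continuous_pi fun i => ?_
    obtain ⟨p, -, hp⟩ := hb_poly i
    simp only [hp]
    exact MvPolynomial.continuous_eval p
  have hh := proj_cont a ahat ha hahat
  have hMc : IsClosed M := by
    rw [hM, Set.setOf_forall]
    exact isClosed_iInter fun k =>
      isClosed_eq (MvPolynomial.continuous_eval (q k)) continuous_const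
  have hEa : ∀ x ∈ E, ahat x = a x := by
    intro x hx
    have h1 := frob_le ((hahat x).2 _ (hA0 x hx))
    simp only [sub_self, Matrix.zero_apply] at h1
    ext i j
    have h2 : ((a x - ahat x) i j) ^ 2 ≤ ∑ i, ∑ j, ((a x - ahat x) i j) ^ 2 := by
      refine le_trans ?_ (Finset.single_le_sum (f := fun i => ∑ j, ((a x - ahat x) i j) ^ 2)
        (fun i _ => by positivity) (Finset.mem_univ i))
      exact Finset.single_le_sum (f := fun j => ((a x - ahat x) i j) ^ 2)
        (fun i _ => by positivity) (Finset.mem_univ j)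
    have h3 : ((a x - ahat x) i j) ^ 2 ≤ 0 := by
      refine h2.trans (h1.trans ?_)
      simp
    have h4 : (a x - ahat x) i j = 0 := by nlinarith
    rw [Matrix.sub_apply] at h4
    linarith
  have hEM : E ⊆ M := by rw [hE]; exact fun x hx => hx.1
  let J : (Fin d → ℝ) → Matrix (Fin m) (Fin d) ℝ := fun x => Matrix.of fun k i =>
    eval x (pderiv i (q k))
  have hJ : Continuous J := continuous_matrix fun k i => MvPolynomial.continuous_eval _
  let c : (Fin d → ℝ) → Fin m → ℝ := fun x k =>
    -(1 / 2) * ∑ i, ∑ j, (ahat x i j - a x i j) * eval x (pderiv i (pderiv j (q k)))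
  have hc : Continuous c := by
    refine continuous_pi fun k => ?_
    have := fun i j => MvPolynomial.continuous_eval (pderiv i (pderiv j (q k)))
    fun_prop
  have hdet : ∀ x ∈ M, (J x * (J x)ᵀ).det ≠ 0 := by
    intro x hx
    have h1 : Function.Injective (J x).vecMul := Matrix.vecMul_injective_iff.2 (hG1 x hx)
    have h2 := Matrix.PosDef.mul_conjTranspose_self (J x) h1
    rw [Matrix.conjTranspose_eq_transpose_of_trivial] at h2
    exact h2.det_pos.ne'
  let v : (Fin d → ℝ) → Fin d → ℝ := fun x => b x + (J x)ᵀ *ᵥ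
    ((J x * (J x)ᵀ).det⁻¹ • ((J x * (J x)ᵀ).adjugate *ᵥ c x))
  have hv : ContinuousOn v M := by
    have hJJ : Continuous fun x => J x * (J x)ᵀ := hJ.matrix_mul hJ.matrix_transpose
    have hd : ContinuousOn (fun x => (J x * (J x)ᵀ).det⁻¹) M :=
      hJJ.matrix_det.continuousOn.inv₀ hdet
    have h1 : ContinuousOn (fun x => (J x * (J x)ᵀ).det⁻¹ •
        ((J x * (J x)ᵀ).adjugate *ᵥ c x)) M :=
      hd.smul (hJJ.matrix_adjugate.matrix_mulVec hc).continuousOn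
    refine hb.continuousOn.add ?_
    rw [continuousOn_iff_continuous_restrict] at h1 ⊢
    exact (hJ.comp continuous_subtype_val).matrix_transpose.matrix_mulVec h1
  have hJv : ∀ x ∈ M, J x *ᵥ v x = J x *ᵥ b x + c x := by
    intro x hx
    simp only [v]
    rw [Matrix.mulVec_add, Matrix.mulVec_mulVec, Matrix.mulVec_smul, Matrix.mulVec_mulVec,
      Matrix.mul_adjugate, Matrix.smul_mulVec, smul_smul, inv_mul_cancel₀ (hdet x hx)]
    simp
  obtain ⟨g, hg⟩ := ContinuousMap.exists_restrict_eq hMc (⟨M.restrict v, hv.restrict⟩ : C(M, Fin d → ℝ))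
  have hgv : ∀ x ∈ M, g x = v x := fun x hx => congrArg (fun F => F ⟨x, hx⟩) hg
  have hgE : ∀ x ∈ E, g x = b x := by
    intro x hx
    have : c x = 0 := by
      ext k
      simp [c, hEa x hx]
    rw [hgv x (hEM hx)]
    simp [v, this]
  refine ⟨g, g.continuous, hgE, ?_, ?_⟩
  · intro f _ x hx
    simp only [GopC, hEa x hx, hgE x hx]
  · intro k x hx
    have h1 := (hA2 x hx k).2
    have h2 := congrFun (hJv x hx) k
    rw [GopC_mv] at h1 ⊢
    rw [hgv x hx]
    simp only [Pi.add_apply, Matrix.mulVec, dotProduct, J, Matrix.of_apply, c, sub_mul,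
      Finset.sum_sub_distrib] at h2
    simp only [mul_comm (b x _), mul_comm (v x _)] at h1 ⊢
    linarith
end
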